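/- Let Q > 1, let X and Y be complete Ahlfors Q-regular metric spaces (with respect to their Q-dimensional Hausdorff measures, with constant C_A), and let f : X → Y be a homeomorphism satisfying the η-quasisymmetry condition. Assume in addition that X satisfies the following codimension-one relative isoperimetric inequality: there is a constant C_I > 0 such that for every Borel set E ⊆ X and every ball B(x,r), min{H^Q(B(x,r)∩E), H^Q(B(x,r)\E)} ≤ C_I · r · H^{Q-1}(∂*E ∩ B(x,r)). Let U₀ ⊆ X satisfy H^Q(f(U₀)) = 0. Then the family of all Borel sets E ⊆ X for which H^{Q-1}(f(Σ E ∩ U₀)) > 0 has Mod_{Q/(Q-1)} equal to zero, where in computing the modulus each such set E is assigned the measure H^{Q-1} restricted to ∂*E, and the base measure on X is H^Q. -/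

import Mathlib

open Metric MeasureTheory Filter Topology ENNReal NNReal Set

noncomputable section

variable {X Y : Type*} [MetricSpace X] [MetricSpace Y]
  [MeasurableSpace X] [BorelSpace X] [MeasurableSpace Y] [BorelSpace Y]

/-- `f` satisfies the `η`-quasisymmetry condition, where `η : [0,∞) → [0,∞)` is a
homeomorphism. -/
def IsQuasisymmetric (η : ℝ≥0 ≃ₜ ℝ≥0) (f : X → Y) : Prop :=
  ∀ ⦃x y z : X⦄, x ≠ y → x ≠ z → y ≠ z → ∀ t : ℝ≥0, 0 < t →
    nndist x y ≤ t * nndist x z → nndist (f x) (f y) ≤ η t * nndist (f x) (f z)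

/-- A measure `μ` on a metric space `X` (with at least two points) is Ahlfors `Q`-regular with
constant `C ≥ 1` if `r^Q/C ≤ μ(B(x,r)) ≤ C·r^Q` for every `x` and `0 < r < 2·diam X`. -/
def AhlforsRegular (X : Type*) [MetricSpace X] [MeasurableSpace X] (μ : Measure X)
    (Q : ℝ) (C : ℝ≥0) : Prop :=
  1 ≤ C ∧ ∀ (x : X) (r : ℝ), 0 < r → ENNReal.ofReal r < 2 * EMetric.diam (Set.univ : Set X) →
    ENNReal.ofReal r ^ Q / C ≤ μ (Metric.ball x r) ∧
      μ (Metric.ball x r) ≤ C * ENNReal.ofReal r ^ Q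

/-- The upper density of `E` at `x` with respect to the measure `μ`. -/
def upperDensity (μ : Measure X) (E : Set X) (x : X) : ℝ≥0∞ :=
  limsup (fun r : ℝ => μ (Metric.ball x r ∩ E) / μ (Metric.ball x r)) (𝓝[>] (0 : ℝ))

/-- The lower density of `E` at `x` with respect to the measure `μ`. -/
def lowerDensity (μ : Measure X) (E : Set X) (x : X) : ℝ≥0∞ :=
  liminf (fun r : ℝ => μ (Metric.ball x r ∩ E) / μ (Metric.ball x r)) (𝓝[>] (0 : ℝ))

/-- The measure-theoretic boundary `∂*E`, with densities w.r.t. `H^Q`. -/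
def mBdry (Q : ℝ) (E : Set X) : Set X :=
  {x | 0 < upperDensity (μH[Q] : Measure X) E x ∧ 0 < upperDensity (μH[Q] : Measure X) Eᶜ x}

/-- The set `Σ_β E`, with densities w.r.t. `H^Q`. -/
def SigmaBeta (Q : ℝ) (β : ℝ≥0∞) (E : Set X) : Set X :=
  {x ∈ mBdry Q E | β ≤ lowerDensity (μH[Q] : Measure X) E x ∧
    β ≤ lowerDensity (μH[Q] : Measure X) Eᶜ x}

/-- The set `Σ E = ⋃_{β ∈ (0,1)} Σ_β E`, with densities w.r.t. `H^Q`. -/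
def SigmaSet (Q : ℝ) (E : Set X) : Set X :=
  ⋃ β ∈ Set.Ioo (0 : ℝ≥0∞) 1, SigmaBeta Q β E

/-- The `Q/(Q-1)`-modulus of a family `𝓕` of subsets of `X`, where each `E ∈ 𝓕` is assigned
the measure `H^{Q-1}⌞∂*E` and the base measure is `H^Q`. -/
def ModF (Q : ℝ) (𝓕 : Set (Set X)) : ℝ≥0∞ :=
  ⨅ ρ ∈ {ρ : X → ℝ≥0∞ | Measurable ρ ∧
      ∀ E ∈ 𝓕, 1 ≤ ∫⁻ x in mBdry Q E, ρ x ∂(μH[Q - 1] : Measure X)},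
    ∫⁻ x, ρ x ^ (Q / (Q - 1)) ∂(μH[Q] : Measure X)

namespace AhlforsRegular

variable {Z : Type*} [MetricSpace Z] [MeasurableSpace Z] {μ : Measure Z} {Q : ℝ} {C : ℝ≥0}

theorem measure_ball_le [Nontrivial Z] (h : AhlforsRegular Z μ Q C) (hQ : 0 ≤ Q) (x : Z) {r : ℝ}
    (hr : 0 < r) : μ (ball x r) ≤ C * ENNReal.ofReal r ^ Q := by
  by_cases hlt : ENNReal.ofReal r < 2 * ediam (Set.univ : Set Z)
  · exact (h.2 x r hr hlt).2
  have hle : 2 * ediam (Set.univ : Set Z) ≤ ENNReal.ofReal r := not_lt.mp hlt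
  have htop : ediam (Set.univ : Set Z) ≠ ⊤ := by
    intro hd
    rw [hd, ENNReal.mul_top (by norm_num)] at hle
    exact ENNReal.ofReal_ne_top (top_le_iff.mp hle)
  obtain ⟨y, hy⟩ := exists_ne x
  have hd (w : Z) : dist x w ≤ (ediam (Set.univ : Set Z)).toReal := by
    rw [dist_edist]
    exact ENNReal.toReal_mono htop (edist_le_ediam_of_mem (mem_univ _) (mem_univ _))
  set d := (ediam (Set.univ : Set Z)).toReal with hdd
  have hed : ediam (Set.univ : Set Z) = ENNReal.ofReal d := (ENNReal.ofReal_toReal htop).symm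
  have hdpos : 0 < d := (dist_pos.mpr hy.symm).trans_le (hd y)
  have h2 : (2 : ℝ≥0∞) * ENNReal.ofReal d = ENNReal.ofReal (2 * d) := by
    rw [ENNReal.ofReal_mul (by norm_num)]; simp
  have hdr : 2 * d ≤ r := by
    rw [hed, h2] at hle
    exact (ENNReal.ofReal_le_ofReal_iff hr.le).mp hle
  calc μ (ball x r) ≤ μ (ball x (3 / 2 * d)) := by
        refine measure_mono fun w _ => ?_
        rw [mem_ball']
        linarith [hd w]
    _ ≤ C * ENNReal.ofReal (3 / 2 * d) ^ Q := by
        refine (h.2 x (3 / 2 * d) (by positivity) ?_).2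
        change _ < 2 * ediam (Set.univ : Set Z)
        rw [hed, h2]
        exact (ENNReal.ofReal_lt_ofReal_iff (by positivity)).mpr (by linarith)
    _ ≤ C * ENNReal.ofReal r ^ Q := by
        gcongr
        linarith

theorem ne_zero (h : AhlforsRegular Z μ Q C) : (C : ℝ≥0∞) ≠ 0 :=
  ENNReal.coe_ne_zero.mpr (zero_lt_one.trans_le h.1).ne'

theorem measure_ball_ne_top [Nontrivial Z] (h : AhlforsRegular Z μ Q C) (hQ : 0 ≤ Q) (x : Z)
    (r : ℝ) : μ (ball x r) ≠ ⊤ := by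
  rcases le_or_gt r 0 with hr | hr
  · simp [ball_eq_empty.mpr hr]
  · exact ((h.measure_ball_le hQ x hr).trans_lt (ENNReal.mul_lt_top ENNReal.coe_lt_top
      (ENNReal.rpow_lt_top_of_nonneg hQ ENNReal.ofReal_ne_top))).ne

theorem rpow_le_mul_measure_ball (h : AhlforsRegular Z μ Q C) (x : Z) {r : ℝ} (hr : 0 < r)
    (hlt : ENNReal.ofReal r < 2 * ediam (Set.univ : Set Z)) :
    ENNReal.ofReal r ^ Q ≤ C * μ (ball x r) := by
  have := (h.2 x r hr hlt).1
  rwa [ENNReal.div_le_iff h.ne_zero ENNReal.coe_ne_top, mul_comm] at this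

theorem measure_ball_pos [Nontrivial Z] (h : AhlforsRegular Z μ Q C) (x : Z) {r : ℝ}
    (hr : 0 < r) : 0 < μ (ball x r) := by
  obtain ⟨y, hy⟩ := exists_ne x
  have hd : 0 < dist x y := dist_pos.mpr hy.symm
  have hlt : ENNReal.ofReal (min r (dist x y)) < 2 * ediam (Set.univ : Set Z) := by
    calc ENNReal.ofReal (min r (dist x y)) ≤ edist x y := by
          rw [edist_dist]; exact ENNReal.ofReal_le_ofReal (min_le_right _ _)
      _ < 2 * edist x y := by
          rw [two_mul]
          exact ENNReal.lt_add_right (edist_ne_top _ _) (edist_pos.mpr hy.symm).ne'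
      _ ≤ _ := by gcongr; exact edist_le_ediam_of_mem (mem_univ _) (mem_univ _)
  have h1 := h.rpow_le_mul_measure_ball x (lt_min hr hd) hlt
  have h2 : 0 < ENNReal.ofReal (min r (dist x y)) ^ Q :=
    ENNReal.rpow_pos (ENNReal.ofReal_pos.mpr (lt_min hr hd)) ENNReal.ofReal_ne_top
  have h3 := h2.trans_le h1
  refine (pos_iff_ne_zero.mpr fun h0 => ?_ : 0 < μ (ball x (min r (dist x y)))).trans_le
    (measure_mono (ball_subset_ball (min_le_left _ _)))
  simp [h0] at h3

theorem outerRegular [BorelSpace Z] [Nontrivial Z] (h : AhlforsRegular Z μ Q C) (hQ : 0 ≤ Q) :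
    μ.OuterRegular := by
  obtain ⟨x, -, -⟩ := exists_pair_ne Z
  refine Measure.FiniteSpanningSetsIn.outerRegular
    { set := fun n => ball x n, set_mem := fun n => ⟨isOpen_ball, ?_⟩,
      finite := fun n => (h.measure_ball_ne_top hQ x n).lt_top, spanning := iUnion_ball_nat x }
  have : IsFiniteMeasure (μ.restrict (ball x n)) :=
    ⟨by simpa using (h.measure_ball_ne_top hQ x n).lt_top⟩
  infer_instance

/-- Inclusion of balls controls radii in a regular space. -/
theorem radius_le_of_ball_subset [Nontrivial Z] (h : AhlforsRegular Z μ Q C) (hQ : 0 < Q)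
    {x y : Z} {r s : ℝ} (hr : 0 < r) (hs : 0 < s)
    (hlt : ENNReal.ofReal r < 2 * ediam (Set.univ : Set Z)) (hsub : ball x r ⊆ ball y s) :
    r ≤ ((C : ℝ) * C) ^ Q⁻¹ * s := by
  have h1 : ENNReal.ofReal r ^ Q ≤ C * (C * ENNReal.ofReal s ^ Q) :=
    (h.rpow_le_mul_measure_ball x hr hlt).trans
      (mul_le_mul_right ((measure_mono hsub).trans (h.measure_ball_le hQ.le y hs)) _)
  have hC : 0 ≤ (C : ℝ) := C.2
  rw [ENNReal.ofReal_rpow_of_pos hr, ENNReal.ofReal_rpow_of_pos hs, ← ENNReal.ofReal_coe_nnreal,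
    ← ENNReal.ofReal_mul hC, ← ENNReal.ofReal_mul hC,
    ENNReal.ofReal_le_ofReal_iff (by positivity)] at h1
  rw [← Real.rpow_le_rpow_iff hr.le (by positivity) hQ, Real.mul_rpow (by positivity) hs.le,
    ← Real.rpow_mul (by positivity), inv_mul_cancel₀ hQ.ne', Real.rpow_one]
  linarith

end AhlforsRegular

/-- The distance from `x` to the set of points which `f` moves farther than `R` from `f x`. -/
def qsRadius {X Y : Type*} [MetricSpace X] [MetricSpace Y] (f : X → Y) (x : X) (R : ℝ) : ℝ :=
  infDist x {z | R < dist (f z) (f x)}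

section Quasisymmetry

variable {X Y : Type*} [MetricSpace X] [MetricSpace Y] {f : X → Y} {x : X} {R : ℝ}

theorem qsRadius_pos (hf : Continuous f) (hR : 0 < R) (hne : ∃ z, R < dist (f z) (f x)) :
    0 < qsRadius f x R := by
  have hcl : IsClosed {z | R ≤ dist (f z) (f x)} :=
    isClosed_le continuous_const (hf.dist continuous_const)
  have hx : x ∉ closure {z | R < dist (f z) (f x)} := fun h => by
    have hle : R ≤ dist (f x) (f x) :=
      closure_minimal (fun z (hz : R < dist (f z) (f x)) => hz.le) hcl h
    rw [dist_self] at hle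
    linarith
  have hne' : {z | R < dist (f z) (f x)}.Nonempty := hne
  exact (infDist_pos_iff_notMem_closure hne').mp hx

theorem qsRadius_le_dist {z : X} (hz : R < dist (f z) (f x)) : qsRadius f x R ≤ dist x z :=
  infDist_le_dist_of_mem hz

theorem ball_qsRadius_subset : ball x (qsRadius f x R) ⊆ f ⁻¹' closedBall (f x) R := by
  intro z hz
  by_contra h
  rw [mem_preimage, mem_closedBall, not_le] at h
  rw [mem_ball'] at hz
  linarith [qsRadius_le_dist h]

theorem ofReal_qsRadius_lt [Nontrivial X] (hne : ∃ z, R < dist (f z) (f x)) :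
    ENNReal.ofReal (qsRadius f x R) < 2 * ediam (Set.univ : Set X) := by
  obtain ⟨z, hz⟩ := hne
  obtain ⟨y, hy⟩ := exists_ne x
  have hle : ENNReal.ofReal (qsRadius f x R) ≤ ediam (Set.univ : Set X) := by
    refine (ENNReal.ofReal_le_ofReal (qsRadius_le_dist hz)).trans ?_
    rw [← edist_dist]
    exact edist_le_ediam_of_mem (mem_univ _) (mem_univ _)
  have hpos : 0 < ediam (Set.univ : Set X) :=
    (edist_pos.mpr hy).trans_le (edist_le_ediam_of_mem (mem_univ _) (mem_univ _))
  rcases eq_or_ne (ediam (Set.univ : Set X)) ⊤ with h | h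
  · rw [h, ENNReal.mul_top (by norm_num)]
    exact ENNReal.ofReal_lt_top
  · rw [two_mul]
    exact hle.trans_lt (ENNReal.lt_add_right h hpos.ne')

theorem NNReal.homeomorph_zero (η : ℝ≥0 ≃ₜ ℝ≥0) : η 0 = 0 := by
  rcases η.continuous.strictMono_of_inj η.injective with h | h
  · obtain ⟨a, ha⟩ := η.surjective 0
    exact le_antisymm ((h.monotone zero_le).trans_eq ha) zero_le
  · obtain ⟨a, ha⟩ := η.surjective (η 0 + 1)
    have := h.antitone (zero_le : 0 ≤ a)
    rw [ha] at this
    exact absurd this (not_le.mpr (lt_add_one _))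

theorem IsQuasisymmetric.exists_preimage_closedBall_subset {η : ℝ≥0 ≃ₜ ℝ≥0}
    (hf : IsQuasisymmetric η f) (hcont : Continuous f) {l : ℝ} (hl : 0 < l) :
    ∃ H : ℝ, 0 < H ∧ ∀ (x : X) (R : ℝ), 0 < R → (∃ z, R < dist (f z) (f x)) →
      f ⁻¹' closedBall (f x) (l * R) ⊆ ball x (H * qsRadius f x R) := by
  lift l to ℝ≥0 using hl.le
  have hl' : 0 < l := by exact_mod_cast hl
  set t := η.symm l⁻¹ with ht
  have hηt : η t = l⁻¹ := η.apply_symm_apply _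
  have htpos : 0 < t := by
    rw [pos_iff_ne_zero]
    intro h0
    rw [h0, NNReal.homeomorph_zero] at hηt
    exact (inv_pos.mpr hl').ne hηt
  have htpos' : (0 : ℝ) < t := by exact_mod_cast htpos
  refine ⟨max 2 (2 / t), by positivity, fun x R hR hne w hw => ?_⟩
  have hrpos := qsRadius_pos hcont hR hne
  have hlt : infDist x {z | R < dist (f z) (f x)} < 2 * qsRadius f x R := by
    change qsRadius f x R < _
    linarith
  obtain ⟨z, hz, hxz⟩ := (infDist_lt_iff hne).mp hlt
  rw [mem_ball']
  have hz' : R < dist (f z) (f x) := hz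
  have h1 : 2 * qsRadius f x R ≤ max 2 (2 / (t : ℝ)) * qsRadius f x R := by
    gcongr; exact le_max_left _ _
  have h2 : 2 / t * qsRadius f x R ≤ max 2 (2 / (t : ℝ)) * qsRadius f x R := by
    gcongr; exact le_max_right _ _
  rcases eq_or_ne x w with rfl | hxw
  · rw [dist_self]; positivity
  rcases eq_or_ne z w with rfl | hzw
  · linarith
  have hxz' : x ≠ z := by
    rintro rfl
    rw [dist_self] at hz'
    linarith
  have key : ¬ dist x z ≤ t * dist x w := by
    intro hle
    have h3 : dist (f x) (f z) ≤ (l : ℝ)⁻¹ * dist (f x) (f w) := by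
      have := hf hxz' hxw hzw t htpos (by exact_mod_cast hle)
      rw [hηt] at this
      exact_mod_cast this
    have h4 : dist (f x) (f w) ≤ l * R := by rw [dist_comm]; exact hw
    have h5 : (l : ℝ)⁻¹ * dist (f x) (f w) ≤ (l : ℝ)⁻¹ * (l * R) := by gcongr
    rw [inv_mul_cancel_left₀ hl.ne'] at h5
    rw [dist_comm] at hz'
    linarith
  have h6 : t * dist x w < 2 * qsRadius f x R := (not_le.mp key).trans hxz
  have h7 : dist x w < 2 / t * qsRadius f x R := by
    rw [div_mul_eq_mul_div, lt_div_iff₀ htpos']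
    linarith
  linarith

theorem exists_forall_qsRadius_lt (hinj : Function.Injective f) [(𝓝[≠] x).NeBot] {δ : ℝ}
    (hδ : 0 < δ) : ∃ R₀ > 0, ∀ R < R₀, qsRadius f x R < δ ∧ ∃ z, R < dist (f z) (f x) := by
  have hev : ∀ᶠ z in 𝓝[≠] x, z ∈ ball x δ ∧ z ≠ x :=
    inter_mem (nhdsWithin_le_nhds (ball_mem_nhds x hδ)) self_mem_nhdsWithin
  obtain ⟨z, hz, hzx⟩ := hev.exists
  refine ⟨dist (f z) (f x), dist_pos.mpr (hinj.ne hzx), fun R hR => ⟨?_, z, hR⟩⟩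
  exact (qsRadius_le_dist hR).trans_lt (mem_ball'.mp hz)

end Quasisymmetry

/-- A radius comparable to the distance to the complement of `V`, truncated at the scale `s`. -/
def whitneyRadius {Y : Type*} [MetricSpace Y] (V : Set Y) (s : ℝ) (y : Y) : ℝ :=
  min s (infDist y Vᶜ) / 10

section Whitney

variable {Y : Type*} [MetricSpace Y] {V : Set Y} {s : ℝ}

theorem whitneyRadius_le (y : Y) : whitneyRadius V s y ≤ s / 10 := by
  unfold whitneyRadius
  gcongr
  exact min_le_left _ _

theorem whitneyRadius_le_add_dist (y z : Y) :
    10 * whitneyRadius V s y ≤ 10 * whitneyRadius V s z + dist y z := by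
  unfold whitneyRadius
  have h := infDist_le_infDist_add_dist (s := Vᶜ) (x := y) (y := z)
  have : min s (infDist y Vᶜ) ≤ min s (infDist z Vᶜ) + dist y z := by
    rcases min_cases s (infDist z Vᶜ) with ⟨h1, -⟩ | ⟨h1, -⟩ <;> rw [h1]
    · linarith [min_le_left s (infDist y Vᶜ), dist_nonneg (x := y) (y := z)]
    · exact (min_le_right _ _).trans h
  linarith

theorem whitneyRadius_pos (hV : IsOpen V) (hne : Vᶜ.Nonempty) (hs : 0 < s) {y : Y} (hy : y ∈ V) :
    0 < whitneyRadius V s y := by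
  have : 0 < infDist y Vᶜ := (hV.isClosed_compl.notMem_iff_infDist_pos hne).mp (by simpa using hy)
  unfold whitneyRadius
  positivity

theorem closedBall_whitneyRadius_subset (hV : IsOpen V) (hne : Vᶜ.Nonempty) (hs : 0 < s) {y : Y}
    (hy : y ∈ V) : closedBall y (whitneyRadius V s y) ⊆ V := by
  intro z hz
  by_contra hzV
  have h1 : infDist y Vᶜ ≤ dist y z := infDist_le_dist_of_mem hzV
  have h2 : 10 * whitneyRadius V s y ≤ infDist y Vᶜ := by
    unfold whitneyRadius
    linarith [min_le_right s (infDist y Vᶜ)]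
  rw [mem_closedBall'] at hz
  linarith [whitneyRadius_pos hV hne hs hy]

theorem whitneyRadius_comparable {y y' z : Y}
    (hy' : y' ∈ closedBall y (whitneyRadius V s y))
    (hz : y' ∈ closedBall z (5 * whitneyRadius V s z)) :
    whitneyRadius V s y ≤ 2 * whitneyRadius V s z ∧
      closedBall z (whitneyRadius V s z) ⊆ closedBall y (20 * whitneyRadius V s y) := by
  rw [mem_closedBall] at hy' hz
  have h1 := whitneyRadius_le_add_dist (V := V) (s := s) y z
  have h2 := whitneyRadius_le_add_dist (V := V) (s := s) z y
  have h3 := dist_triangle_left y z y'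
  rw [dist_comm z y] at h2
  have h4 : 0 ≤ whitneyRadius V s y := dist_nonneg.trans hy'
  have h5 : 0 ≤ whitneyRadius V s z := by linarith [dist_nonneg.trans hz]
  refine ⟨by linarith, closedBall_subset_closedBall' ?_⟩
  rw [dist_comm z y]
  linarith

theorem exists_countable_whitney_cover [MeasurableSpace Y] [OpensMeasurableSpace Y]
    {μ : Measure Y} (hμ : ∀ (y : Y) (r : ℝ), 0 < r → 0 < μ (closedBall y r)) (hV : IsOpen V)
    (hne : Vᶜ.Nonempty) (hVfin : μ V ≠ ⊤) (hs : 0 < s) {t : Set Y} (ht : t ⊆ V) :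
    ∃ u ⊆ t, u.Countable ∧ (u.PairwiseDisjoint fun y => closedBall y (whitneyRadius V s y)) ∧
      ∀ y ∈ t, ∃ z ∈ u, y ∈ closedBall z (5 * whitneyRadius V s z) := by
  obtain ⟨u, hut, hdisj, hcov⟩ := Vitali.exists_disjoint_subfamily_covering_enlargement_closedBall
    t id (whitneyRadius V s) (s / 10) (fun y _ => whitneyRadius_le y) 5 (by norm_num)
  refine ⟨u, hut, ?_, hdisj, fun y hy => ?_⟩
  · have hcount := Measure.countable_meas_pos_of_disjoint_of_meas_iUnion_ne_top μ
      (As := fun y : u => closedBall (y : Y) (whitneyRadius V s y))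
      (fun _ => measurableSet_closedBall)
      (fun a b hab => hdisj a.2 b.2 (Subtype.coe_injective.ne hab))
      (measure_ne_top_of_subset (iUnion_subset fun y =>
        closedBall_whitneyRadius_subset hV hne hs (ht (hut y.2))) hVfin)
    have huniv : {i : u | 0 < μ (closedBall (i : Y) (whitneyRadius V s i))} = Set.univ :=
      eq_univ_of_forall fun i => hμ _ _ (whitneyRadius_pos hV hne hs (ht (hut i.2)))
    rw [huniv] at hcount
    exact countable_coe_iff.mp (countable_univ_iff.mp hcount)
  · obtain ⟨z, hz, hsub⟩ := hcov y hy
    exact ⟨z, hz, hsub (mem_closedBall_self (whitneyRadius_pos hV hne hs (ht hy)).le)⟩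

end Whitney

theorem weight_rpow_mul_eq {Q R r H : ℝ} (hQ : 1 < Q) (hR : 0 < R) (hr : 0 < r) (hH : 0 < H) :
    ENNReal.ofReal ((R / r) ^ (Q - 1)) ^ (Q / (Q - 1)) * ENNReal.ofReal (H * r) ^ Q =
      ENNReal.ofReal H ^ Q * ENNReal.ofReal R ^ Q := by
  have hQ1 : 0 < Q - 1 := by linarith
  rw [ENNReal.ofReal_rpow_of_pos (by positivity), ENNReal.ofReal_rpow_of_pos (by positivity),
    ENNReal.ofReal_rpow_of_pos hH, ENNReal.ofReal_rpow_of_pos hR,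
    ← ENNReal.ofReal_mul (by positivity), ← ENNReal.ofReal_mul (by positivity),
    ← Real.rpow_mul (by positivity), mul_div_cancel₀ _ hQ1.ne', Real.div_rpow hR.le hr.le,
    Real.mul_rpow hH.le hr.le]
  congr 1
  field_simp

theorem le_weight_mul_of_isoperimetric {Q R r M C_I : ℝ} {C : ℝ≥0} {β ν h : ℝ≥0∞}
    (hR : 0 < R) (hr : 0 < r) (hM : 0 < M) (hCI : 0 < C_I) (hC : 1 ≤ C)
    (hiso : β * ν ≤ ENNReal.ofReal (C_I * r) * h) (hν : ENNReal.ofReal r ^ Q ≤ C * ν) :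
    ENNReal.ofReal ((20 * M) ^ (Q - 1) * C * C_I)⁻¹ * β * ENNReal.ofReal (10 * R) ^ (Q - 1) ≤
      ENNReal.ofReal ((R / (2 * M * r)) ^ (Q - 1)) * h := by
  have hC' : (0 : ℝ) < C := by exact_mod_cast zero_lt_one.trans_le hC
  have hid : (R / (2 * M * r)) ^ (Q - 1) = ((20 * M) ^ (Q - 1) * C * C_I)⁻¹ *
      (10 * R) ^ (Q - 1) * (r ^ (-Q) * C) * (C_I * r) := by
    have h1 : R / (2 * M * r) = 10 * R / (20 * M) / r := by field_simp; norm_num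
    rw [h1, Real.div_rpow (by positivity) hr.le, Real.div_rpow (by positivity) (by positivity),
      Real.rpow_sub_one hr.ne', Real.rpow_neg hr.le]
    field_simp
  have hone : 1 ≤ ENNReal.ofReal (r ^ (-Q) * C) * ν := by
    calc (1 : ℝ≥0∞) = ENNReal.ofReal (r ^ (-Q)) * ENNReal.ofReal r ^ Q := by
          rw [ENNReal.ofReal_rpow_of_pos hr, ← ENNReal.ofReal_mul (by positivity),
            ← Real.rpow_add hr]
          simp
      _ ≤ ENNReal.ofReal (r ^ (-Q)) * (C * ν) := by gcongr
      _ = ENNReal.ofReal (r ^ (-Q) * C) * ν := by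
          rw [ENNReal.ofReal_mul (by positivity), ENNReal.ofReal_coe_nnreal, mul_assoc]
  rw [hid, ENNReal.ofReal_rpow_of_pos (by positivity), ENNReal.ofReal_mul (by positivity),
    ENNReal.ofReal_mul (by positivity), ENNReal.ofReal_mul (by positivity)]
  set c := ENNReal.ofReal ((20 * M) ^ (Q - 1) * C * C_I)⁻¹
  set T := ENNReal.ofReal ((10 * R) ^ (Q - 1))
  calc c * β * T = c * T * (β * 1) := by ring
    _ ≤ c * T * (β * (ENNReal.ofReal (r ^ (-Q) * C) * ν)) := by gcongr
    _ = c * T * ENNReal.ofReal (r ^ (-Q) * C) * (β * ν) := by ring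
    _ ≤ c * T * ENNReal.ofReal (r ^ (-Q) * C) * (ENNReal.ofReal (C_I * r) * h) := by gcongr
    _ = _ := by ring

theorem rpow_iSup_le_tsum {ι : Type*} {p : ℝ} (hp : 0 < p) (g : ι → ℝ≥0∞) :
    (⨆ i, g i) ^ p ≤ ∑' i, g i ^ p := by
  rw [← ENNReal.le_rpow_inv_iff hp]
  exact iSup_le fun i => (ENNReal.le_rpow_inv_iff hp).mpr (ENNReal.le_tsum i)

/-- A countable Whitney family `u`, seen from the domain, yields a weight of small energy. -/
theorem lintegral_iSup_weight_le {X Y : Type*} [MetricSpace X] [MetricSpace Y] [Nontrivial X]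
    [MeasurableSpace X] [BorelSpace X] [MeasurableSpace Y] [BorelSpace Y] {Q : ℝ} (hQ : 1 < Q)
    {C : ℝ≥0} {μ : Measure X} {ν : Measure Y} (hX : AhlforsRegular X μ Q C)
    (hY : AhlforsRegular Y ν Q C) (f : X ≃ₜ Y) {H : ℝ} (hH : 0 < H) {u : Set Y}
    (hu : u.Countable) {R r : Y → ℝ} (hR : ∀ y ∈ u, 0 < R y) (hr : ∀ y ∈ u, 0 < r y)
    (hRlt : ∀ y ∈ u, ENNReal.ofReal (R y) < 2 * ediam (Set.univ : Set Y))
    (hdisj : u.PairwiseDisjoint fun y => closedBall y (R y)) {V : Set Y}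
    (hV : ∀ y ∈ u, closedBall y (R y) ⊆ V)
    (hsub : ∀ y ∈ u, f ⁻¹' closedBall y (5 * R y) ⊆ ball (f.symm y) (H * r y)) :
    ∫⁻ x, (⨆ y : u, (f ⁻¹' closedBall (y : Y) (5 * R y)).indicator
      (fun _ => ENNReal.ofReal ((R y / r y) ^ (Q - 1))) x) ^ (Q / (Q - 1)) ∂μ ≤
      C * ENNReal.ofReal H ^ Q * C * ν V := by
  have : Countable u := hu.to_subtype
  have hp : 0 < Q / (Q - 1) := div_pos (by linarith) (by linarith)
  have hms (y : u) : MeasurableSet (f ⁻¹' closedBall (y : Y) (5 * R y)) :=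
    f.continuous.measurable measurableSet_closedBall
  calc _ ≤ ∫⁻ x, ∑' y : u, (f ⁻¹' closedBall (y : Y) (5 * R y)).indicator
        (fun _ => ENNReal.ofReal ((R y / r y) ^ (Q - 1)) ^ (Q / (Q - 1))) x ∂μ := by
        refine lintegral_mono fun x => (rpow_iSup_le_tsum hp _).trans_eq (tsum_congr fun y => ?_)
        by_cases hx : x ∈ f ⁻¹' closedBall (y : Y) (5 * R y)
        · rw [indicator_of_mem hx, indicator_of_mem hx]
        · rw [indicator_of_notMem hx, indicator_of_notMem hx, ENNReal.zero_rpow_of_pos hp]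
    _ = ∑' y : u, ENNReal.ofReal ((R y / r y) ^ (Q - 1)) ^ (Q / (Q - 1)) *
          μ (f ⁻¹' closedBall (y : Y) (5 * R y)) := by
        rw [lintegral_tsum fun y => (measurable_const.indicator (hms y)).aemeasurable]
        exact tsum_congr fun y => lintegral_indicator_const (hms y) _
    _ ≤ ∑' y : u, C * ENNReal.ofReal H ^ Q * C * ν (closedBall (y : Y) (R y)) := by
        refine ENNReal.tsum_le_tsum fun y => ?_
        have hry := hr y y.2
        calc _ ≤ ENNReal.ofReal ((R y / r y) ^ (Q - 1)) ^ (Q / (Q - 1)) *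
              (C * ENNReal.ofReal (H * r y) ^ Q) := by
              gcongr
              exact (measure_mono (hsub y y.2)).trans
                (hX.measure_ball_le (by linarith) _ (by positivity))
          _ = C * ENNReal.ofReal H ^ Q * ENNReal.ofReal (R y) ^ Q := by
              rw [mul_left_comm, weight_rpow_mul_eq hQ (hR y y.2) hry hH, mul_assoc]
          _ ≤ C * ENNReal.ofReal H ^ Q * (C * ν (closedBall (y : Y) (R y))) := by
              gcongr
              exact (hY.rpow_le_mul_measure_ball _ (hR y y.2) (hRlt y y.2)).trans
                (mul_le_mul_right (measure_mono ball_subset_closedBall) _)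
          _ = _ := by ring
    _ = C * ENNReal.ofReal H ^ Q * C * ν (⋃ y ∈ u, closedBall y (R y)) := by
        rw [ENNReal.tsum_mul_left, measure_biUnion hu hdisj fun _ _ => measurableSet_closedBall]
    _ ≤ _ := by
        gcongr
        exact iUnion₂_subset hV

/-- The size-`δ` Hausdorff pre-measure is bounded by the sum over a countable cover by balls. -/
theorem pre_le_tsum_closedBall {Y : Type*} [MetricSpace Y] {d δ : ℝ} (hd : 0 ≤ d) {u B : Set Y}
    (hu : u.Countable) {R : Y → ℝ} (hR : ∀ y ∈ u, 10 * R y ≤ δ)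
    (hcov : ∀ y ∈ B, ∃ z ∈ u, y ∈ closedBall z (5 * R z)) :
    OuterMeasure.mkMetric'.pre (fun t : Set Y => ediam t ^ d) (ENNReal.ofReal δ) B ≤
      ∑' y : u, ENNReal.ofReal (10 * R y) ^ d := by
  have : Countable u := hu.to_subtype
  have hdiam (z : Y) : ediam (closedBall z (5 * R z)) ≤ ENNReal.ofReal (10 * R z) := by
    refine ediam_le fun a ha b hb => ?_
    rw [edist_dist]
    refine ENNReal.ofReal_le_ofReal ?_
    rw [mem_closedBall] at ha hb
    linarith [dist_triangle_right a b z]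
  calc _ ≤ OuterMeasure.mkMetric'.pre (fun t : Set Y => ediam t ^ d) (ENNReal.ofReal δ)
        (⋃ z : u, closedBall (z : Y) (5 * R z)) := by
        refine measure_mono fun y hy => ?_
        obtain ⟨z, hz, hyz⟩ := hcov y hy
        exact mem_iUnion.mpr ⟨⟨z, hz⟩, hyz⟩
    _ ≤ ∑' z : u, OuterMeasure.mkMetric'.pre (fun t : Set Y => ediam t ^ d) (ENNReal.ofReal δ)
        (closedBall (z : Y) (5 * R z)) := measure_iUnion_le _
    _ ≤ _ := by
        refine ENNReal.tsum_le_tsum fun z => ?_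
        refine (OuterMeasure.mkMetric'.pre_le ((hdiam z).trans
          (ENNReal.ofReal_le_ofReal (hR z z.2)))).trans ?_
        exact ENNReal.rpow_le_rpow (hdiam z) hd

theorem exists_lt_dist_of_lt_half_dist {Y : Type*} [MetricSpace Y] {y₁ y₂ : Y} {R : ℝ}
    (hR : R < dist y₁ y₂ / 2) (y : Y) : ∃ z, R < dist z y := by
  by_contra! h
  linarith [h y₁, h y₂, dist_triangle_right y₁ y₂ y]

/-- At every scale there is a weight of arbitrarily small energy whose integral over the
measure-theoretic boundary of `E` controls the Hausdorff pre-measure of the image of any part of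
`U₀` where `E` and its complement are uniformly thick. -/
theorem exists_weight_of_null_image {X Y : Type*} [MetricSpace X] [MetricSpace Y]
    [MeasurableSpace X] [BorelSpace X] [MeasurableSpace Y] [BorelSpace Y] {Q : ℝ} (hQ : 1 < Q)
    [Nontrivial X] [Nontrivial Y] {C : ℝ≥0}
    (hX : AhlforsRegular X (μH[Q] : Measure X) Q C)
    (hY : AhlforsRegular Y (μH[Q] : Measure Y) Q C)
    (η : ℝ≥0 ≃ₜ ℝ≥0) (f : X ≃ₜ Y) (hf : IsQuasisymmetric η f) {C_I : ℝ} (hCI : 0 < C_I)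
    (hiso : ∀ E : Set X, MeasurableSet E → ∀ (x : X) (r : ℝ), 0 < r →
      min (μH[Q] (ball x r ∩ E)) (μH[Q] (ball x r \ E)) ≤
        ENNReal.ofReal (C_I * r) * μH[Q - 1] (mBdry Q E ∩ ball x r))
    (U₀ : Set X) (hU₀ : μH[Q] (f '' U₀) = 0) :
    ∃ c : ℝ≥0∞, c ≠ 0 ∧ ∀ ε : ℝ≥0∞, 0 < ε → ∀ s : ℝ, 0 < s → ∃ ρ : X → ℝ≥0∞, Measurable ρ ∧
      ∫⁻ x, ρ x ^ (Q / (Q - 1)) ∂(μH[Q] : Measure X) ≤ ε ∧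
      ∀ E : Set X, MeasurableSet E → ∀ β : ℝ≥0∞, ∀ A ⊆ U₀,
        (∀ x ∈ A, ∀ R : ℝ, 0 < R → R < s →
          β * μH[Q] (ball x (qsRadius f x R)) ≤
            min (μH[Q] (ball x (qsRadius f x R) ∩ E)) (μH[Q] (ball x (qsRadius f x R) \ E))) →
        c * β * OuterMeasure.mkMetric'.pre (fun t : Set Y => ediam t ^ (Q - 1))
          (ENNReal.ofReal s) (f '' A) ≤ ∫⁻ x in mBdry Q E, ρ x ∂(μH[Q - 1] : Measure X) := by
  have hQ0 : 0 < Q := by linarith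
  have hC1 : (1 : ℝ) ≤ C := by exact_mod_cast hX.1
  obtain ⟨H, hH, hHsub⟩ :=
    hf.exists_preimage_closedBall_subset f.continuous (l := 20) (by norm_num)
  obtain ⟨y₁, y₂, hy⟩ := exists_pair_ne Y
  set M : ℝ := ((C : ℝ) * C) ^ Q⁻¹ * H with hMdef
  have hM : 0 < M := by positivity
  refine ⟨ENNReal.ofReal ((20 * M) ^ (Q - 1) * C * C_I)⁻¹,
    (ENNReal.ofReal_pos.mpr (by positivity)).ne', fun ε hε s₁ hs₁ => ?_⟩
  set s := min s₁ (dist y₁ y₂ / 2) with hsdef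
  have hs : 0 < s := lt_min hs₁ (half_pos (dist_pos.mpr hy))
  set D : ℝ≥0∞ := C * ENNReal.ofReal H ^ Q * C with hD
  have hDtop : D ≠ ⊤ := ENNReal.mul_ne_top (ENNReal.mul_ne_top ENNReal.coe_ne_top
    (ENNReal.rpow_ne_top_of_nonneg hQ0.le ENNReal.ofReal_ne_top)) ENNReal.coe_ne_top
  have : (μH[Q] : Measure Y).OuterRegular := hY.outerRegular hQ0.le
  have hYpos : 0 < μH[Q] (Set.univ : Set Y) :=
    (hY.measure_ball_pos y₁ one_pos).trans_le (measure_mono (subset_univ _))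
  obtain ⟨V, hUV, hV, hVlt⟩ := (f '' U₀).exists_isOpen_lt_of_lt
    (min (ε / D) (μH[Q] (Set.univ : Set Y)))
    (by rw [hU₀]; exact lt_min (ENNReal.div_pos hε.ne' hDtop) hYpos)
  have hne : Vᶜ.Nonempty := by
    rw [nonempty_compl]
    rintro rfl
    exact lt_irrefl _ (hVlt.trans_le (min_le_right _ _))
  have hball (y : Y) (r : ℝ) (hr : 0 < r) : 0 < μH[Q] (closedBall y r) :=
    (hY.measure_ball_pos y hr).trans_le (measure_mono ball_subset_closedBall)
  set R : Y → ℝ := whitneyRadius V s with hRdef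
  set r : Y → ℝ := fun y => qsRadius f (f.symm y) (R y) with hrdef
  have hRpos (y) (hy : y ∈ V) : 0 < R y := whitneyRadius_pos hV hne hs hy
  have hRs (y) : 10 * R y ≤ s := by linarith [whitneyRadius_le (V := V) (s := s) y]
  have hRlt (y) : R y < dist y₁ y₂ / 2 := by
    linarith [hRs y, min_le_right s₁ (dist y₁ y₂ / 2), dist_pos.mpr hy]
  have hfar (y) : ∃ z, R y < dist (f z) (f (f.symm y)) := by
    obtain ⟨z, hz⟩ := exists_lt_dist_of_lt_half_dist (hRlt y) y
    exact ⟨f.symm z, by simpa using hz⟩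
  have hrpos (y) (hy : y ∈ V) : 0 < r y := qsRadius_pos f.continuous (hRpos y hy) (hfar y)
  have hrlt (y) : ENNReal.ofReal (r y) < 2 * ediam (Set.univ : Set X) :=
    ofReal_qsRadius_lt (hfar y)
  have hinner (y) : ball (f.symm y) (r y) ⊆ f ⁻¹' closedBall y (R y) := by
    simpa using ball_qsRadius_subset (f := f) (x := f.symm y) (R := R y)
  have houter (y) (hy : y ∈ V) : f ⁻¹' closedBall y (20 * R y) ⊆ ball (f.symm y) (H * r y) := by
    simpa using hHsub (f.symm y) (R y) (hRpos y hy) (hfar y)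
  have hRdiam (y) : ENNReal.ofReal (R y) < 2 * ediam (Set.univ : Set Y) := by
    have h1 : ENNReal.ofReal (R y) < edist y₁ y₂ := by
      rw [edist_dist, ENNReal.ofReal_lt_ofReal_iff (dist_pos.mpr hy)]
      linarith [hRlt y, dist_pos.mpr hy]
    calc ENNReal.ofReal (R y) < edist y₁ y₂ := h1
      _ ≤ ediam (Set.univ : Set Y) := edist_le_ediam_of_mem (mem_univ _) (mem_univ _)
      _ ≤ _ := by rw [two_mul]; exact le_self_add
  obtain ⟨u, huV, hucount, hudisj, hucov⟩ := exists_countable_whitney_cover hball hV hne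
    (hVlt.trans_le (min_le_right _ _)).ne_top hs subset_rfl
  set ρ : X → ℝ≥0∞ := fun x => ⨆ y : u, (f ⁻¹' closedBall (y : Y) (5 * R y)).indicator
      (fun _ => ENNReal.ofReal ((R y / r y) ^ (Q - 1))) x with hρ
  have hmeas (y : Y) (t : ℝ) : MeasurableSet (f ⁻¹' closedBall y t) :=
    f.continuous.measurable measurableSet_closedBall
  have hlower (y) (hy : y ∈ V) (x : X) (hx : x ∈ f ⁻¹' closedBall y (R y)) :
      ENNReal.ofReal ((R y / (2 * M * r y)) ^ (Q - 1)) ≤ ρ x := by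
    have hxV : f x ∈ V := closedBall_whitneyRadius_subset hV hne hs hy hx
    obtain ⟨z, hz, hxz⟩ := hucov (f x) hxV
    have hzV := huV hz
    obtain ⟨h1, h2⟩ := whitneyRadius_comparable hx hxz
    have hrz : r z ≤ M * r y := by
      rw [hMdef, mul_assoc]
      exact hX.radius_le_of_ball_subset hQ0 (hrpos z hzV) (mul_pos hH (hrpos y hy)) (hrlt z)
        ((hinner z).trans ((preimage_mono h2).trans (houter y hy)))
    have hzpos := hrpos z hzV
    have hypos := hrpos y hy
    have hRy := hRpos y hy
    have hRz := hRpos z hzV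
    calc ENNReal.ofReal ((R y / (2 * M * r y)) ^ (Q - 1))
        ≤ ENNReal.ofReal ((R z / r z) ^ (Q - 1)) := by
          refine ENNReal.ofReal_le_ofReal (Real.rpow_le_rpow (by positivity) ?_ (by linarith))
          rw [div_le_div_iff₀ (by positivity) hzpos]
          calc R y * r z ≤ (2 * R z) * (M * r y) := by gcongr
            _ = _ := by ring
      _ ≤ ρ x := by
          refine le_iSup_of_le ⟨z, hz⟩ ?_
          rw [indicator_of_mem (show x ∈ f ⁻¹' closedBall z (5 * R z) from hxz)]
  refine ⟨ρ, ?_, ?_, fun E hE β A hA hdens => ?_⟩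
  · have : Countable u := hucount.to_subtype
    exact Measurable.iSup fun y => measurable_const.indicator (hmeas y _)
  · refine (lintegral_iSup_weight_le hQ hX hY f hH hucount (fun y hy => hRpos y (huV hy))
      (fun y hy => hrpos y (huV hy)) (fun y _ => hRdiam y) hudisj
      (fun y hy => closedBall_whitneyRadius_subset hV hne hs (huV hy)) fun y hy => ?_).trans ?_
    · refine Subset.trans (preimage_mono (closedBall_subset_closedBall ?_)) (houter y (huV hy))
      linarith [hRpos y (huV hy)]
    · calc D * μH[Q] V ≤ D * (ε / D) := by gcongr; exact (hVlt.trans_le (min_le_left _ _)).le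
        _ ≤ ε := ENNReal.mul_div_le
  have hAV : f '' A ⊆ V := (image_mono hA).trans hUV
  obtain ⟨v, hvA, hvcount, hvdisj, hvcov⟩ := exists_countable_whitney_cover hball hV hne
    (hVlt.trans_le (min_le_right _ _)).ne_top hs hAV
  have : Countable v := hvcount.to_subtype
  set c : ℝ≥0∞ := ENNReal.ofReal ((20 * M) ^ (Q - 1) * C * C_I)⁻¹
  calc c * β * OuterMeasure.mkMetric'.pre (fun t : Set Y => ediam t ^ (Q - 1))
          (ENNReal.ofReal s₁) (f '' A)
      ≤ c * β * ∑' y : v, ENNReal.ofReal (10 * R y) ^ (Q - 1) := by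
        gcongr
        exact pre_le_tsum_closedBall (by linarith) hvcount
          (fun y _ => (hRs y).trans (min_le_left _ _)) hvcov
    _ = ∑' y : v, c * β * ENNReal.ofReal (10 * R y) ^ (Q - 1) := ENNReal.tsum_mul_left.symm
    _ ≤ ∑' y : v, ∫⁻ x in f ⁻¹' closedBall (y : Y) (R y), ρ x
          ∂((μH[Q - 1] : Measure X).restrict (mBdry Q E)) := by
        refine ENNReal.tsum_le_tsum fun y => ?_
        obtain ⟨x, hxA, hxy⟩ := hvA y.2
        have hyV := hAV (hvA y.2)
        have hx : f.symm (y : Y) = x := by rw [← hxy, f.symm_apply_apply]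
        have hd : β * μH[Q] (ball (f.symm y) (r y)) ≤ ENNReal.ofReal (C_I * r y) *
            μH[Q - 1] (mBdry Q E ∩ ball (f.symm y) (r y)) := by
          refine le_trans ?_ (hiso E hE (f.symm y) (r y) (hrpos y hyV))
          simp only [hrdef]
          rw [hx]
          refine hdens x hxA (R y) (hRpos y hyV) ?_
          linarith [hRs y, hRpos y hyV, min_le_left s₁ (dist y₁ y₂ / 2)]
        refine (le_weight_mul_of_isoperimetric (hRpos y hyV) (hrpos y hyV) hM hCI hX.1 hd
          (hX.rpow_le_mul_measure_ball _ (hrpos y hyV) (hrlt y))).trans ?_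
        calc ENNReal.ofReal ((R y / (2 * M * r y)) ^ (Q - 1)) *
              μH[Q - 1] (mBdry Q E ∩ ball (f.symm y) (r y))
            ≤ ENNReal.ofReal ((R y / (2 * M * r y)) ^ (Q - 1)) *
              (μH[Q - 1] : Measure X).restrict (mBdry Q E) (f ⁻¹' closedBall (y : Y) (R y)) := by
              rw [Measure.restrict_apply (hmeas y _), inter_comm]
              gcongr
              exact hinner y
          _ ≤ _ := by
              rw [← setLIntegral_const]
              exact setLIntegral_mono' (hmeas y _) (hlower y hyV)
    _ = ∫⁻ x in ⋃ y : v, f ⁻¹' closedBall (y : Y) (R y), ρ x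
          ∂((μH[Q - 1] : Measure X).restrict (mBdry Q E)) :=
        (lintegral_iUnion (fun y : v => hmeas y _) (fun a b hab => Disjoint.preimage f
          (hvdisj a.2 b.2 (Subtype.coe_injective.ne hab))) _).symm
    _ ≤ ∫⁻ x in mBdry Q E, ρ x ∂(μH[Q - 1] : Measure X) := setLIntegral_le_lintegral _ _

/-- The points of `U₀` at which `E` and its complement fill a proportion `1 / (m + 1)` of every
ball `ball x (qsRadius f x R)` with `R < 1 / (m + 1)`. -/
def thickPart {X Y : Type*} [MetricSpace X] [MetricSpace Y] [MeasurableSpace X] [BorelSpace X]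
    (Q : ℝ) (f : X → Y) (U₀ E : Set X) (m : ℕ) : Set X :=
  {x | x ∈ U₀ ∧ ∀ R : ℝ, 0 < R → R < 1 / ((m : ℝ) + 1) →
    ((m : ℝ≥0∞) + 1)⁻¹ * μH[Q] (ball x (qsRadius f x R)) ≤
      min (μH[Q] (ball x (qsRadius f x R) ∩ E)) (μH[Q] (ball x (qsRadius f x R) \ E))}

theorem exists_pre_pos_of_hausdorffMeasure_pos {Y : Type*} [MetricSpace Y] [MeasurableSpace Y]
    [BorelSpace Y] {d : ℝ} {A : Set Y} (hA : 0 < μH[d] A) :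
    ∃ δ > 0, 0 < OuterMeasure.mkMetric'.pre (fun t : Set Y => ediam t ^ d) δ A := by
  by_contra! h
  have h0 : μH[d] A = 0 := by
    rw [Measure.hausdorffMeasure, ← OuterMeasure.coe_mkMetric, OuterMeasure.mkMetric,
      OuterMeasure.mkMetric']
    simp only [OuterMeasure.iSup_apply]
    exact le_antisymm (iSup₂_le h) zero_le
  exact hA.ne' h0

theorem AhlforsRegular.neBot_nhdsNE {X : Type*} [MetricSpace X] [MeasurableSpace X] [BorelSpace X]
    [Nontrivial X] {Q : ℝ} {C : ℝ≥0} (hQ : 0 < Q)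
    (hX : AhlforsRegular X (μH[Q] : Measure X) Q C) (x : X) : (𝓝[≠] x).NeBot := by
  refine ⟨fun hbot => ?_⟩
  obtain ⟨ε, hε, hsub⟩ := Metric.isOpen_iff.mp ((isOpen_singleton_iff_punctured_nhds x).mpr hbot)
    x rfl
  have := Measure.nullSingletonClass_hausdorff X hQ
  exact (hX.measure_ball_pos x hε).ne' (measure_mono_null hsub (measure_singleton x))

theorem exists_forall_mul_le_of_lt_lowerDensity {X : Type*} [MetricSpace X] [MeasurableSpace X]
    {μ : Measure X} {E : Set X} {x : X} {β : ℝ≥0∞}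
    (h : β < lowerDensity μ E x) :
    ∃ δ > 0, ∀ r : ℝ, 0 < r → r < δ → β * μ (ball x r) ≤ μ (ball x r ∩ E) := by
  obtain ⟨δ, hδ, hsub⟩ := mem_nhdsGT_iff_exists_Ioo_subset.mp (eventually_lt_of_lt_liminf h)
  exact ⟨δ, hδ, fun r h0 hr => ENNReal.mul_le_of_le_div (le_of_lt (hsub ⟨h0, hr⟩))⟩

theorem sigmaSet_inter_subset_iUnion_thickPart {X Y : Type*} [MetricSpace X] [MetricSpace Y]
    [MeasurableSpace X] [BorelSpace X] [Nontrivial X] {Q : ℝ} {C : ℝ≥0} (hQ : 0 < Q)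
    (hX : AhlforsRegular X (μH[Q] : Measure X) Q C) {f : X → Y} (hf : Continuous f)
    (hinj : Function.Injective f) (U₀ E : Set X) :
    SigmaSet Q E ∩ U₀ ⊆ ⋃ m, thickPart Q f U₀ E m := by
  rintro x ⟨hx, hxU⟩
  obtain ⟨β, ⟨hβ0, hβ1⟩, -, hE, hEc⟩ := mem_iUnion₂.mp hx
  have hlt : β / 2 < β := ENNReal.half_lt_self hβ0.ne' (hβ1.trans ENNReal.one_lt_top).ne
  obtain ⟨δ₁, hδ₁, h₁⟩ := exists_forall_mul_le_of_lt_lowerDensity (hlt.trans_le hE)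
  obtain ⟨δ₂, hδ₂, h₂⟩ := exists_forall_mul_le_of_lt_lowerDensity (hlt.trans_le hEc)
  have := hX.neBot_nhdsNE hQ x
  obtain ⟨R₀, hR₀, hrad⟩ := exists_forall_qsRadius_lt (x := x) hinj (lt_min hδ₁ hδ₂)
  obtain ⟨m₁, hm₁⟩ := exists_nat_one_div_lt hR₀
  obtain ⟨m₂, hm₂⟩ := ENNReal.exists_inv_nat_lt (ENNReal.half_pos hβ0.ne').ne'
  refine mem_iUnion.mpr ⟨max m₁ m₂, hxU, fun R hR hRm => ?_⟩
  have hm : (((max m₁ m₂ : ℕ) : ℝ≥0∞) + 1)⁻¹ ≤ β / 2 := by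
    refine le_trans (ENNReal.inv_le_inv.mpr ?_) hm₂.le
    exact (Nat.cast_le.mpr (le_max_right m₁ m₂)).trans le_self_add
  obtain ⟨hlt, hne⟩ := hrad R
    (hRm.trans ((Nat.one_div_le_one_div (le_max_left m₁ m₂)).trans_lt hm₁))
  have hpos := qsRadius_pos hf hR hne
  refine (mul_le_mul_left hm _).trans (le_min ?_ ?_)
  · exact h₁ _ hpos (hlt.trans_le (min_le_left _ _))
  · exact h₂ _ hpos (hlt.trans_le (min_le_right _ _))

theorem exists_measure_pos_thickPart {X Y : Type*} [MetricSpace X] [MetricSpace Y]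
    [MeasurableSpace X] [BorelSpace X] [MeasurableSpace Y] [BorelSpace Y] [Nontrivial X] {Q : ℝ} {C : ℝ≥0} (hQ : 1 < Q)
    (hX : AhlforsRegular X (μH[Q] : Measure X) Q C) (f : X → Y) (hf : Continuous f)
    (hinj : Function.Injective f) (U₀ : Set X) {E : Set X}
    (hpos : 0 < μH[Q - 1] (f '' (SigmaSet Q E ∩ U₀))) :
    ∃ m, 0 < μH[Q - 1] (f '' thickPart Q f U₀ E m) := by
  by_contra! h
  refine hpos.ne' (measure_mono_null (image_mono
    (sigmaSet_inter_subset_iUnion_thickPart (by linarith) hX hf hinj U₀ E)) ?_)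
  rw [image_iUnion]
  exact measure_iUnion_null fun m => nonpos_iff_eq_zero.mp (h m)

/-- under a codimension-one relative isoperimetric inequality on `X`, if
`H^Q(f(U₀)) = 0` then the family of Borel sets `E` with `H^{Q-1}(f(Σ E ∩ U₀)) > 0` has
`Q/(Q-1)`-modulus zero. -/
theorem stmt15 {Q : ℝ} (hQ : 1 < Q) [Nontrivial X] [Nontrivial Y]
    [CompleteSpace X] [CompleteSpace Y] {C_A : ℝ≥0}
    (hAX : AhlforsRegular X (μH[Q] : Measure X) Q C_A)
    (hAY : AhlforsRegular Y (μH[Q] : Measure Y) Q C_A)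
    (η : ℝ≥0 ≃ₜ ℝ≥0) (f : X ≃ₜ Y) (hf : IsQuasisymmetric η (⇑f))
    {C_I : ℝ} (hCI : 0 < C_I)
    (hiso : ∀ E : Set X, MeasurableSet E → ∀ (x : X) (r : ℝ), 0 < r →
      min (μH[Q] (Metric.ball x r ∩ E)) (μH[Q] (Metric.ball x r \ E)) ≤
        ENNReal.ofReal (C_I * r) * μH[Q - 1] (mBdry Q E ∩ Metric.ball x r))
    (U₀ : Set X) (hU₀ : μH[Q] (⇑f '' U₀) = 0) :
    ModF Q {E : Set X | MeasurableSet E ∧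
      0 < μH[Q - 1] (⇑f '' (SigmaSet Q E ∩ U₀))} = 0 := by
  have hQ1 : 0 < Q - 1 := by linarith
  have hp : 0 < Q / (Q - 1) := div_pos (by linarith) hQ1
  obtain ⟨c, hc, hweight⟩ := exists_weight_of_null_image hQ hAX hAY η f hf hCI hiso U₀ hU₀
  refine le_antisymm (le_of_forall_gt_imp_ge_of_dense fun δ hδ => ?_) zero_le
  obtain ⟨ε, hε, hεsum⟩ := ENNReal.exists_pos_sum_of_countable' hδ.ne' ℕ
  have hbudget (n : ℕ) : 0 < ε n / (n : ℝ≥0∞) ^ (Q / (Q - 1)) :=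
    ENNReal.div_pos (hε n).ne' (ENNReal.rpow_ne_top_of_nonneg hp.le (ENNReal.natCast_ne_top n))
  choose ρ hρmeas hρint hρlow using fun n : ℕ =>
    hweight _ (hbudget n) (1 / ((n : ℝ) + 1)) Nat.one_div_pos_of_nat
  refine iInf₂_le_of_le (fun x => ⨆ n : ℕ, n * ρ n x)
    ⟨Measurable.iSup fun n => (hρmeas n).const_mul _, ?_⟩ ?_
  · rintro E ⟨hE, hpos⟩
    obtain ⟨m, hm⟩ := exists_measure_pos_thickPart hQ hAX f f.continuous f.injective U₀ hpos
    obtain ⟨δ₀, hδ₀, hpre⟩ := exists_pre_pos_of_hausdorffMeasure_pos hm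
    set κ := OuterMeasure.mkMetric'.pre (fun t : Set Y => ediam t ^ (Q - 1)) δ₀
      (f '' thickPart Q f U₀ E m)
    have hτ : c * ((m : ℝ≥0∞) + 1)⁻¹ * κ ≠ 0 :=
      mul_ne_zero (mul_ne_zero hc (by simp)) hpre.ne'
    obtain ⟨k, hk⟩ := ENNReal.exists_nat_mul_gt hτ ENNReal.one_ne_top
    have hev : ∀ᶠ n : ℕ in atTop, ENNReal.ofReal (1 / ((n : ℝ) + 1)) < δ₀ := by
      have ht := ENNReal.tendsto_ofReal (tendsto_one_div_add_atTop_nhds_zero_nat (𝕜 := ℝ))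
      rw [ENNReal.ofReal_zero] at ht
      exact ht.eventually_lt_const hδ₀
    obtain ⟨n, hnδ, hnk, hnm⟩ :=
      (hev.and ((eventually_ge_atTop k).and (eventually_ge_atTop m))).exists
    have hlow := hρlow n E hE ((m : ℝ≥0∞) + 1)⁻¹ (thickPart Q f U₀ E m) (fun x hx => hx.1)
      (fun x hx R hR hRn => hx.2 R hR (hRn.trans_le (Nat.one_div_le_one_div hnm)))
    calc (1 : ℝ≥0∞) ≤ k * (c * ((m : ℝ≥0∞) + 1)⁻¹ * κ) := hk.le
      _ ≤ n * ∫⁻ x in mBdry Q E, ρ n x ∂(μH[Q - 1] : Measure X) := by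
          gcongr
          refine le_trans ?_ hlow
          gcongr
          exact OuterMeasure.mkMetric'.mono_pre _ hnδ.le _
      _ = ∫⁻ x in mBdry Q E, n * ρ n x ∂(μH[Q - 1] : Measure X) :=
          (lintegral_const_mul _ (hρmeas n)).symm
      _ ≤ _ := lintegral_mono fun x => le_iSup (fun n : ℕ => (n : ℝ≥0∞) * ρ n x) n
  · calc ∫⁻ x, (⨆ n : ℕ, n * ρ n x) ^ (Q / (Q - 1)) ∂(μH[Q] : Measure X)
        ≤ ∫⁻ x, ∑' n : ℕ, (n : ℝ≥0∞) ^ (Q / (Q - 1)) * ρ n x ^ (Q / (Q - 1))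
            ∂(μH[Q] : Measure X) := by
          refine lintegral_mono fun x => (rpow_iSup_le_tsum hp _).trans_eq ?_
          exact tsum_congr fun n => ENNReal.mul_rpow_of_nonneg _ _ hp.le
      _ = ∑' n : ℕ, (n : ℝ≥0∞) ^ (Q / (Q - 1)) *
            ∫⁻ x, ρ n x ^ (Q / (Q - 1)) ∂(μH[Q] : Measure X) := by
          rw [lintegral_tsum fun n => (((hρmeas n).pow_const _).const_mul _).aemeasurable]
          exact tsum_congr fun n => lintegral_const_mul _ ((hρmeas n).pow_const _)
      _ ≤ ∑' n, ε n := by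
          refine ENNReal.tsum_le_tsum fun n => ?_
          exact (mul_le_mul_right (hρint n) _).trans ENNReal.mul_div_le
      _ ≤ δ := hεsum.le
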